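/- Let p ≥ 1, q = p/(p−1), ν < 1, and let f be measurable on (0,∞) with ‖f‖_{ν,p} < ∞. Then for every τ ≥ 0 the index transform admits the composition representation (F f)(τ) = ∫_0^∞ cos(2uτ)·( ∫_0^∞ K_0(4·x^{1/4}·(cosh u)^{1/2})·f(x) dx ) du, where K_0(y) = ∫_0^∞ exp(−y·cosh t) dt, and the iterated integral converges absolutely. -/

import Mathlib

open MeasureTheory Set Filter Asymptotics

/-- Modified Bessel function of the second kind (integral representation, for Re z > 0). -/
noncomputable def besselK (nu z : ℂ) : ℂ :=
  ∫ t in Set.Ioi (0:ℝ), Complex.exp (-z * (Real.cosh t : ℂ)) * Complex.cosh (nu * (t : ℂ))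

/-- The kernel 𝒦(x,τ) = ker²_{2iτ}(2(4x)^{1/4}) + kei²_{2iτ}(2(4x)^{1/4})
    = K_{2iτ}(2(4x)^{1/4}e^{iπ/4}) · K_{2iτ}(2(4x)^{1/4}e^{-iπ/4}), which is real. -/
noncomputable def kernelK (x τ : ℝ) : ℝ :=
  (besselK (2 * Complex.I * (τ:ℂ))
      (((2 * (4*x) ^ ((1:ℝ)/4) : ℝ) : ℂ) * Complex.exp (Complex.I * (Real.pi:ℂ) / 4)) *
   besselK (2 * Complex.I * (τ:ℂ))
      (((2 * (4*x) ^ ((1:ℝ)/4) : ℝ) : ℂ) * Complex.exp (-(Complex.I * (Real.pi:ℂ)) / 4))).re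

/-- K₀(y) = ∫₀^∞ exp(−y·cosh t) dt. -/
noncomputable def besselK0 (y : ℝ) : ℝ := ∫ t in Set.Ioi (0:ℝ), Real.exp (-y * Real.cosh t)

/-- K_{iτ}(x) = ∫₀^∞ exp(−x·cosh t)·cos(τt) dt (real-valued, purely imaginary order). -/
noncomputable def besselKi (τ x : ℝ) : ℝ :=
  ∫ t in Set.Ioi (0:ℝ), Real.exp (-x * Real.cosh t) * Real.cos (τ * t)

/-- Modified Bessel function of the first kind I_ν(z) (power series). -/
noncomputable def besselI (nu z : ℂ) : ℂ :=
  ∑' n : ℕ, (z/2) ^ (nu + 2*(n:ℂ)) / ((n.factorial : ℂ) * Complex.Gamma (nu + (n:ℂ) + 1))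

/-- B_ν(w) = ber²_ν(w) + bei²_ν(w) = I_ν(w·e^{iπ/4})·I_ν(w·e^{−iπ/4}). -/
noncomputable def kelvinB (nu w : ℂ) : ℂ :=
  besselI nu (w * Complex.exp (Complex.I * (Real.pi:ℂ) / 4)) *
  besselI nu (w * Complex.exp (-(Complex.I * (Real.pi:ℂ)) / 4))

/-- Index transform (1.1): (F f)(τ) = ∫₀^∞ 𝒦(x,τ) f(x) dx. -/
noncomputable def indexF (f : ℝ → ℝ) (τ : ℝ) : ℝ := ∫ x in Set.Ioi (0:ℝ), kernelK x τ * f x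

/-- Index transform (1.2): (G g)(x) = ∫₀^∞ 𝒦(x,τ) g(τ) dτ. -/
noncomputable def indexG (g : ℝ → ℝ) (x : ℝ) : ℝ := ∫ τ in Set.Ioi (0:ℝ), kernelK x τ * g τ

/-- Index transform (1.2) for complex-valued densities. -/
noncomputable def indexGC (g : ℝ → ℂ) (x : ℝ) : ℂ :=
  ∫ τ in Set.Ioi (0:ℝ), (kernelK x τ : ℂ) * g τ

/-- Mellin transform of a real function. -/
noncomputable def mellinT (f : ℝ → ℝ) (s : ℂ) : ℂ :=
  ∫ x in Set.Ioi (0:ℝ), (f x : ℂ) * (x:ℂ) ^ (s - 1)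

/-- Mellin transform of a complex function. -/
noncomputable def mellinC (F : ℝ → ℂ) (s : ℂ) : ℂ :=
  ∫ x in Set.Ioi (0:ℝ), F x * (x:ℂ) ^ (s - 1)

/-- The L_{ν,p}(ℝ₊) norm. -/
noncomputable def Lnorm (ν p : ℝ) (f : ℝ → ℝ) : ℝ :=
  (∫ x in Set.Ioi (0:ℝ), |f x| ^ p * x ^ (ν*p - 1)) ^ (1/p)

/-- Euler beta function B(a,b) = Γ(a)Γ(b)/Γ(a+b). -/
noncomputable def betaFn (a b : ℝ) : ℝ := Real.Gamma a * Real.Gamma b / Real.Gamma (a+b)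

/-! ### Decay of the exponential of the hyperbolic cosine -/

theorem integrable_cosh_rpow_neg {a : ℝ} (ha : 0 < a) :
    Integrable (fun t : ℝ => Real.cosh t ^ (-a)) := by
  have hc : Continuous (fun t : ℝ => Real.cosh t ^ (-a)) :=
    Real.continuous_cosh.rpow_const fun t => Or.inl (Real.cosh_pos t).ne'
  have key (s t : ℝ) (h : Real.exp s / 2 ≤ Real.cosh t) :
      Real.cosh t ^ (-a) ≤ 2 ^ a * Real.exp (-a * s) := by
    calc Real.cosh t ^ (-a) ≤ (Real.exp s / 2) ^ (-a) :=
          Real.rpow_le_rpow_of_nonpos (by positivity) h (by linarith)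
      _ = 2 ^ a * Real.exp (-a * s) := by
          rw [Real.div_rpow (Real.exp_pos s).le zero_le_two, ← Real.exp_mul,
            Real.rpow_neg zero_le_two, div_inv_eq_mul, mul_comm, mul_comm s]
  rw [← integrableOn_univ, ← Iic_union_Ioi (a := (0 : ℝ))]
  refine IntegrableOn.union ?_ ?_
  · refine ((integrableOn_exp_mul_Iic ha 0).const_mul (2 ^ a)).mono'
      hc.aestronglyMeasurable (ae_of_all _ fun t => ?_)
    rw [Real.norm_of_nonneg (Real.rpow_nonneg (Real.cosh_pos t).le _)]
    simpa using key (-t) t (by rw [Real.cosh_eq]; linarith [Real.exp_pos t])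
  · refine ((integrableOn_exp_mul_Ioi (neg_lt_zero.2 ha) 0).const_mul (2 ^ a)).mono'
      hc.aestronglyMeasurable (ae_of_all _ fun t => ?_)
    rw [Real.norm_of_nonneg (Real.rpow_nonneg (Real.cosh_pos t).le _)]
    exact key t t (by rw [Real.cosh_eq]; linarith [Real.exp_pos (-t)])

theorem exp_neg_le_const_mul_rpow_neg {a z : ℝ} (ha : 0 < a) (hz : 0 < z) :
    Real.exp (-z) ≤ a ^ a * z ^ (-a) := by
  have h : (z / a) ^ a ≤ Real.exp z := by
    calc (z / a) ^ a ≤ Real.exp (z / a) ^ a := by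
          gcongr
          linarith [Real.add_one_le_exp (z / a)]
      _ = Real.exp z := by rw [← Real.exp_mul, div_mul_cancel₀ _ ha.ne']
  calc Real.exp (-z) = (Real.exp z)⁻¹ := Real.exp_neg z
    _ ≤ ((z / a) ^ a)⁻¹ := inv_anti₀ (by positivity) h
    _ = a ^ a * z ^ (-a) := by
        rw [Real.div_rpow hz.le ha.le, Real.rpow_neg hz.le, inv_div, div_eq_mul_inv]

theorem exp_neg_mul_cosh_le {a y : ℝ} (ha : 0 < a) (hy : 0 < y) (t : ℝ) :
    Real.exp (-y * Real.cosh t) ≤ a ^ a * y ^ (-a) * Real.cosh t ^ (-a) := by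
  have h := exp_neg_le_const_mul_rpow_neg ha (mul_pos hy (Real.cosh_pos t))
  rwa [Real.mul_rpow hy.le (Real.cosh_pos t).le, ← mul_assoc, ← neg_mul] at h

theorem integrable_exp_neg_mul_cosh {y : ℝ} (hy : 0 < y) :
    Integrable (fun t : ℝ => Real.exp (-y * Real.cosh t)) := by
  refine ((integrable_cosh_rpow_neg one_pos).const_mul (1 ^ (1 : ℝ) * y ^ (-1 : ℝ))).mono'
    (by fun_prop) (ae_of_all _ fun t => ?_)
  rw [Real.norm_of_nonneg (Real.exp_pos _).le]
  exact exp_neg_mul_cosh_le one_pos hy t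

theorem integrable_exp_neg_mul_cosh_mul_cosh {y : ℝ} (hy : 0 < y) :
    Integrable (fun t : ℝ => Real.exp (-y * Real.cosh t) * Real.cosh t) := by
  refine ((integrable_cosh_rpow_neg one_pos).const_mul (2 ^ (2 : ℝ) * y ^ (-2 : ℝ))).mono'
    (by fun_prop) (ae_of_all _ fun t => ?_)
  have hc := Real.cosh_pos t
  rw [Real.norm_of_nonneg (by positivity)]
  calc Real.exp (-y * Real.cosh t) * Real.cosh t
      ≤ 2 ^ (2 : ℝ) * y ^ (-2 : ℝ) * Real.cosh t ^ (-2 : ℝ) * Real.cosh t := by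
        gcongr
        exact exp_neg_mul_cosh_le two_pos hy t
    _ = 2 ^ (2 : ℝ) * y ^ (-2 : ℝ) * Real.cosh t ^ (-1 : ℝ) := by
        rw [mul_assoc, ← Real.rpow_add_one hc.ne']
        norm_num

/-! ### The function `besselK0` -/

theorem besselK0_nonneg (y : ℝ) : 0 ≤ besselK0 y :=
  integral_nonneg fun _ => (Real.exp_pos _).le

theorem measurable_besselK0 : Measurable besselK0 := by
  have h : StronglyMeasurable
      (Function.uncurry fun y t : ℝ => Real.exp (-y * Real.cosh t)) := by
    apply Continuous.stronglyMeasurable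
    fun_prop
  exact (h.integral_prod_right (ν := volume.restrict (Ioi 0))).measurable

theorem exists_besselK0_le {a : ℝ} (ha : 0 < a) :
    ∃ C : ℝ, 0 ≤ C ∧ ∀ y, 0 < y → besselK0 y ≤ C * y ^ (-a) := by
  refine ⟨a ^ a * ∫ t in Ioi (0 : ℝ), Real.cosh t ^ (-a), ?_, fun y hy => ?_⟩
  · exact mul_nonneg (by positivity)
      (integral_nonneg fun t => Real.rpow_nonneg (Real.cosh_pos t).le _)
  calc besselK0 y ≤ ∫ t in Ioi (0 : ℝ), a ^ a * y ^ (-a) * Real.cosh t ^ (-a) :=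
        integral_mono (integrable_exp_neg_mul_cosh hy).integrableOn
          ((integrable_cosh_rpow_neg ha).integrableOn.const_mul _)
          fun t => exp_neg_mul_cosh_le ha hy t
    _ = _ := by rw [integral_const_mul]; ring

theorem exists_besselK0_comp_le {a : ℝ} (ha : 0 < a) :
    ∃ C : ℝ, 0 ≤ C ∧ ∀ u x : ℝ, 0 < x →
      besselK0 (4 * x ^ ((1:ℝ)/4) * Real.sqrt (Real.cosh u)) ≤
        C * Real.cosh u ^ (-(2 * a)) * x ^ (-a) := by
  obtain ⟨C, hC, h⟩ := exists_besselK0_le (a := 4 * a) (by positivity)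
  refine ⟨C * 4 ^ (-(4 * a)), by positivity, fun u x hx => ?_⟩
  have hc := Real.cosh_pos u
  refine (h _ (by positivity)).trans_eq ?_
  rw [Real.mul_rpow (by positivity) (by positivity), Real.mul_rpow (by positivity) (by positivity),
    Real.sqrt_eq_rpow, ← Real.rpow_mul hx.le, ← Real.rpow_mul hc.le]
  ring_nf

theorem integral_exp_neg_mul_cosh (y : ℝ) :
    ∫ t : ℝ, Real.exp (-y * Real.cosh t) = 2 * besselK0 y := by
  rw [besselK0, ← integral_comp_abs]
  simp_rw [Real.cosh_abs]

/-! ### Absolute convergence -/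

theorem le_rpow_add_one {a p : ℝ} (ha : 0 ≤ a) (hp : 1 ≤ p) : a ≤ a ^ p + 1 := by
  rcases le_total a 1 with h | h
  · linarith [Real.rpow_nonneg ha p]
  · linarith [Real.self_le_rpow_of_one_le h hp]

theorem integrableOn_besselK0_mul {p ν : ℝ} (hp : 1 ≤ p) (hν : ν < 1)
    {f : ℝ → ℝ} (hf : Measurable f)
    (hfin : IntegrableOn (fun x => |f x| ^ p * x ^ (ν*p - 1)) (Ioi 0)) :
    IntegrableOn (fun ux : ℝ × ℝ =>
      besselK0 (4 * ux.2 ^ ((1:ℝ)/4) * Real.sqrt (Real.cosh ux.1)) * f ux.2)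
      (Ioi 0 ×ˢ Ioi 0) := by
  have hmK : Measurable fun ux : ℝ × ℝ =>
      besselK0 (4 * ux.2 ^ ((1:ℝ)/4) * Real.sqrt (Real.cosh ux.1)) :=
    measurable_besselK0.comp (by fun_prop)
  have hmf : Measurable fun ux : ℝ × ℝ => f ux.2 := hf.comp measurable_snd
  -- integrability against a function of `x` alone, at the cost of a power of `x`
  have key {a : ℝ} (ha : 0 < a) {s : Set ℝ} (hs : MeasurableSet s) (hs0 : s ⊆ Ioi 0) {g : ℝ → ℝ}
      (hg : Measurable g) (hi : IntegrableOn (fun x => |g x| * x ^ (-a)) s) :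
      IntegrableOn (fun ux : ℝ × ℝ =>
        besselK0 (4 * ux.2 ^ ((1:ℝ)/4) * Real.sqrt (Real.cosh ux.1)) * g ux.2)
        (Ioi 0 ×ˢ s) := by
    obtain ⟨C, hC, hK⟩ := exists_besselK0_comp_le ha
    have hprod := (((integrable_cosh_rpow_neg (a := 2 * a) (by positivity)).const_mul
      C).integrableOn (s := Ioi 0)).mul_prod hi
    rw [Measure.prod_restrict] at hprod
    refine hprod.mono' (hmK.mul (hg.comp measurable_snd)).aestronglyMeasurable ?_
    refine (ae_restrict_iff' (measurableSet_Ioi.prod hs)).2 (ae_of_all _ fun ux hux => ?_)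
    rw [norm_mul, Real.norm_of_nonneg (besselK0_nonneg _), Real.norm_eq_abs]
    refine (mul_le_mul_of_nonneg_right (hK ux.1 ux.2 (hs0 hux.2)) (abs_nonneg _)).trans_eq ?_
    ring
  have h1 := key (sub_pos.2 hν) measurableSet_Ioi subset_rfl
    (g := fun x => |f x| ^ p * x ^ (ν * p - ν)) (by fun_prop)
    (hfin.congr_fun (fun x (hx : 0 < x) => by
      have hnn : 0 ≤ |f x| ^ p * x ^ (ν * p - ν) := by positivity
      simp only
      rw [abs_of_nonneg hnn, mul_assoc, ← Real.rpow_add hx]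
      ring_nf) measurableSet_Ioi)
  have h2 := key (a := (1 - ν) / 2) (by linarith) measurableSet_Ioc (s := Ioc 0 1)
    Ioc_subset_Ioi_self (g := fun x => x ^ (-ν)) (by fun_prop)
    (IntegrableOn.congr_fun ((intervalIntegrable_iff_integrableOn_Ioc_of_le zero_le_one).1
      (intervalIntegral.intervalIntegrable_rpow' (r := -ν + -((1 - ν) / 2)) (by linarith)))
      (fun x hx => by
        have hx : 0 < x := hx.1
        rw [abs_of_nonneg (by positivity), ← Real.rpow_add hx]) measurableSet_Ioc)
  have h3 := key (a := 2 * (1 - ν)) (by linarith) measurableSet_Ioi (s := Ioi 1)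
    (Ioi_subset_Ioi zero_le_one) (g := fun x => x ^ (-ν)) (by fun_prop)
    (IntegrableOn.congr_fun (integrableOn_Ioi_rpow_of_lt (a := -ν + -(2 * (1 - ν)))
      (by linarith) zero_lt_one)
      (fun x hx => by
        have hx : 0 < x := zero_lt_one.trans hx
        rw [abs_of_nonneg (by positivity), ← Real.rpow_add hx]) measurableSet_Ioi)
  have h4 := h2.union h3
  rw [← prod_union, Ioc_union_Ioi_eq_Ioi zero_le_one] at h4
  refine (h1.add h4).mono' (hmK.mul hmf).aestronglyMeasurable ?_
  refine (ae_restrict_iff' (measurableSet_Ioi.prod measurableSet_Ioi)).2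
    (ae_of_all _ fun ux hux => ?_)
  have hx : 0 < ux.2 := hux.2
  rw [norm_mul, Real.norm_of_nonneg (besselK0_nonneg _), Real.norm_eq_abs, Pi.add_apply, ← mul_add]
  refine mul_le_mul_of_nonneg_left ?_ (besselK0_nonneg _)
  have h := le_rpow_add_one (a := |f ux.2| * ux.2 ^ ν) (by positivity) hp
  calc |f ux.2| = |f ux.2| * ux.2 ^ ν * ux.2 ^ (-ν) := by
        rw [mul_assoc, ← Real.rpow_add hx, add_neg_cancel, Real.rpow_zero, mul_one]
    _ ≤ ((|f ux.2| * ux.2 ^ ν) ^ p + 1) * ux.2 ^ (-ν) := by gcongr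
    _ = _ := by
        rw [Real.mul_rpow (abs_nonneg _) (by positivity), ← Real.rpow_mul hx.le, add_mul, one_mul,
          mul_assoc, ← Real.rpow_add hx, ← sub_eq_add_neg]

/-! ### The product of two Macdonald functions with conjugate arguments -/

theorem Complex.cosh_add_ofReal_mul_I (b φ : ℝ) :
    Complex.cosh (b + φ * Complex.I) =
      Real.cosh b * Real.cos φ + Real.sinh b * Real.sin φ * Complex.I := by
  rw [Complex.cosh_add, Complex.cosh_mul_I, Complex.sinh_mul_I]
  push_cast
  ring

theorem norm_cexp_neg_mul_cosh (y b φ : ℝ) :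
    ‖Complex.exp (-y * Complex.cosh (b + φ * Complex.I))‖ =
      Real.exp (-(y * Real.cos φ) * Real.cosh b) := by
  rw [Complex.norm_exp, Complex.cosh_add_ofReal_mul_I, ← Complex.ofReal_neg, Complex.re_ofReal_mul]
  congr 1
  simp [-Complex.ofReal_cosh, -Complex.ofReal_cos, -Complex.ofReal_sinh, -Complex.ofReal_sin]
  ring

theorem norm_sinh_le_cosh_re (w : ℂ) : ‖Complex.sinh w‖ ≤ Real.cosh w.re := by
  rw [Complex.sinh, Real.cosh_eq, norm_div, Complex.norm_ofNat]
  gcongr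
  refine (norm_sub_le _ _).trans_eq ?_
  rw [Complex.norm_exp, Complex.norm_exp, Complex.neg_re]

theorem integrable_cexp_neg_mul_cosh {y φ : ℝ} (hy : 0 < y) (hφ : 0 < Real.cos φ) :
    Integrable (fun b : ℝ => Complex.exp (-y * Complex.cosh (b + φ * Complex.I))) := by
  refine (integrable_exp_neg_mul_cosh (mul_pos hy hφ)).mono' (by fun_prop)
    (ae_of_all _ fun b => (norm_cexp_neg_mul_cosh y b φ).le)

theorem norm_cexp_neg_mul_cosh_mul_sinh_le {y : ℝ} (hy : 0 < y) {c φ : ℝ}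
    (hc : c ≤ Real.cos φ) (b : ℝ) :
    ‖Complex.exp (-y * Complex.cosh (b + φ * Complex.I)) *
        (-y * Complex.sinh (b + φ * Complex.I))‖ ≤
      y * (Real.exp (-(y * c) * Real.cosh b) * Real.cosh b) := by
  have h := norm_sinh_le_cosh_re (b + φ * Complex.I)
  simp only [Complex.add_re, Complex.ofReal_re, Complex.mul_re, Complex.I_re, mul_zero,
    Complex.ofReal_im, Complex.I_im, mul_one, sub_self, add_zero] at h
  rw [norm_mul, norm_mul, norm_neg, Complex.norm_real, Real.norm_of_nonneg hy.le,
    norm_cexp_neg_mul_cosh, mul_left_comm]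
  have := Real.cosh_pos b
  gcongr

theorem integral_cexp_neg_mul_cosh_add_mul_I {y φ : ℝ} (hy : 0 < y)
    (hφ : φ ∈ Ioo (-(Real.pi / 2)) (Real.pi / 2)) :
    ∫ b : ℝ, Complex.exp (-y * Complex.cosh (b + φ * Complex.I)) = 2 * besselK0 y := by
  have hderiv (θ : ℝ) (hθ : θ ∈ Ioo (-(Real.pi / 2)) (Real.pi / 2)) :
      HasDerivAt (fun φ : ℝ => ∫ b : ℝ, Complex.exp (-y * Complex.cosh (b + φ * Complex.I))) 0 θ := by
    obtain ⟨ψ, hψ, hψ2⟩ := exists_between (abs_lt.2 hθ)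
    have hψ0 : 0 ≤ ψ := (abs_nonneg θ).trans hψ.le
    have hcψ : 0 < Real.cos ψ := Real.cos_pos_of_mem_Ioo ⟨by linarith, hψ2⟩
    have hdom := (integrable_exp_neg_mul_cosh_mul_cosh (mul_pos hy hcψ)).const_mul y
    have hcos {x : ℝ} (hx : x ∈ Ioo (-ψ) ψ) : Real.cos ψ ≤ Real.cos x := by
      rw [← Real.cos_abs x]
      exact Real.cos_le_cos_of_nonneg_of_le_pi (abs_nonneg x) (by linarith [Real.pi_pos])
        (abs_lt.2 hx).le
    have hinner (x b : ℝ) : HasDerivAt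
        (fun b : ℝ => Complex.exp (-y * Complex.cosh (b + x * Complex.I)))
        (Complex.exp (-y * Complex.cosh (b + x * Complex.I)) *
          (-y * Complex.sinh (b + x * Complex.I))) b := by
      have := (((Complex.hasDerivAt_cosh _).comp b
        ((hasDerivAt_id b).ofReal_comp.add_const (x * Complex.I))).const_mul (-y : ℂ)).cexp
      simpa using this
    have hangle (x b : ℝ) : HasDerivAt
        (fun x : ℝ => Complex.exp (-y * Complex.cosh (b + x * Complex.I)))
        (Complex.exp (-y * Complex.cosh (b + x * Complex.I)) *
          (-y * Complex.sinh (b + x * Complex.I)) * Complex.I) x := by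
      have := (((Complex.hasDerivAt_cosh _).comp x
        (((hasDerivAt_id x).ofReal_comp.mul_const Complex.I).const_add (b : ℂ))).const_mul
        (-y : ℂ)).cexp
      simpa [mul_assoc] using this
    have hF := (hasDerivAt_integral_of_dominated_loc_of_deriv_le (μ := volume)
      (F := fun x b : ℝ => Complex.exp (-y * Complex.cosh (b + x * Complex.I)))
      (F' := fun x b : ℝ => Complex.exp (-y * Complex.cosh (b + x * Complex.I)) *
          (-y * Complex.sinh (b + x * Complex.I)) * Complex.I)
      (Ioo_mem_nhds (abs_lt.1 hψ).1 (abs_lt.1 hψ).2)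
      (.of_forall fun x => by fun_prop)
      (integrable_cexp_neg_mul_cosh hy (Real.cos_pos_of_mem_Ioo hθ)) (by fun_prop)
      (ae_of_all _ fun b x hx => by
        rw [norm_mul, Complex.norm_I, mul_one]
        exact norm_cexp_neg_mul_cosh_mul_sinh_le hy (hcos hx) b) hdom
      (ae_of_all _ fun b x _ => hangle x b)).2
    rwa [integral_mul_const, integral_eq_zero_of_hasDerivAt_of_integrable (hinner θ)
      (hdom.mono' (by fun_prop) (ae_of_all _ fun b =>
        norm_cexp_neg_mul_cosh_mul_sinh_le hy (hcos (abs_lt.1 hψ)) b))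
      (integrable_cexp_neg_mul_cosh hy (Real.cos_pos_of_mem_Ioo hθ)), zero_mul] at hF
  have hconst := isOpen_Ioo.is_const_of_deriv_eq_zero isPreconnected_Ioo
    (fun θ hθ => (hderiv θ hθ).differentiableAt.differentiableWithinAt)
    (fun θ hθ => (hderiv θ hθ).deriv) hφ
    (show (0 : ℝ) ∈ Ioo (-(Real.pi / 2)) (Real.pi / 2) by constructor <;> linarith [Real.pi_pos])
  rw [hconst]
  have := congrArg Complex.ofReal (integral_exp_neg_mul_cosh y)
  rw [← integral_complex_ofReal] at this
  push_cast at this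
  simpa using this

theorem integral_cexp_neg_mul_cosh_add_cosh {r : ℝ} (hr : 0 < r) (u : ℝ) :
    ∫ s : ℝ, Complex.exp (-(r * (1 + Complex.I)) * Real.cosh s) *
        Complex.exp (-(r * (1 - Complex.I)) * Real.cosh (u - s)) =
      2 * besselK0 (2 * r * Real.sqrt (Real.cosh u)) := by
  have hcu := Real.cosh_pos u
  have hch := Real.cosh_pos (u / 2)
  have hR : 0 < Real.sqrt (Real.cosh u) := Real.sqrt_pos.2 hcu
  have hsq : Real.cosh u = Real.cosh (u / 2) ^ 2 + Real.sinh (u / 2) ^ 2 := by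
    rw [← Real.cosh_two_mul]; ring_nf
  set R := Real.sqrt (Real.cosh u) with hRdef
  have hR2 : R ^ 2 = Real.cosh u := Real.sq_sqrt hcu.le
  set φ := Real.arctan (Real.sinh (u / 2) / Real.cosh (u / 2)) with hφ
  have hroot : Real.sqrt (1 + (Real.sinh (u / 2) / Real.cosh (u / 2)) ^ 2) =
      R / Real.cosh (u / 2) := by
    rw [Real.sqrt_eq_iff_mul_self_eq (by positivity) (by positivity)]
    field_simp
    rw [hR2, hsq]
  have hcos : R * Real.cos φ = Real.cosh (u / 2) := by
    rw [hφ, Real.cos_arctan, hroot]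
    field_simp
  have hsin : R * Real.sin φ = Real.sinh (u / 2) := by
    rw [hφ, Real.sin_arctan, hroot]
    field_simp
  rw [← integral_cexp_neg_mul_cosh_add_mul_I (by positivity) (φ := φ) (Real.arctan_mem_Ioo _),
    ← integral_add_right_eq_self _ (u / 2)]
  congr 1 with b
  rw [← Complex.exp_add, Complex.cosh_add_ofReal_mul_I, Real.cosh_add,
    show u - (b + u / 2) = u / 2 - b by ring, Real.cosh_sub, ← hcos, ← hsin]
  congr 1
  push_cast
  ring

theorem integral_eq_integral_Ioi_add_comp_neg {g : ℝ → ℂ} (hg : Integrable g) :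
    ∫ s, g s = ∫ s in Ioi (0 : ℝ), (g s + g (-s)) := by
  rw [integral_add hg.integrableOn hg.comp_neg.integrableOn, integral_comp_neg_Ioi, neg_zero,
    add_comm, intervalIntegral.integral_Iic_add_Ioi hg.integrableOn hg.integrableOn]

theorem integrable_cexp_mul_cosh_mul_cexp {z : ℂ} (hz : 0 < z.re) (τ : ℝ) :
    Integrable (fun s : ℝ => Complex.exp (-z * Real.cosh s) *
      Complex.exp (2 * Complex.I * τ * s)) := by
  refine (integrable_exp_neg_mul_cosh hz).mono' (by fun_prop) (ae_of_all _ fun s => ?_)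
  rw [norm_mul, Complex.norm_exp, Complex.norm_exp, Complex.re_mul_ofReal, Complex.neg_re]
  simp

theorem integral_cexp_mul_cosh_mul_cexp {z : ℂ} (hz : 0 < z.re) (τ : ℝ) :
    ∫ s : ℝ, Complex.exp (-z * Real.cosh s) * Complex.exp (2 * Complex.I * τ * s) =
      2 * besselK (2 * Complex.I * τ) z := by
  rw [integral_eq_integral_Ioi_add_comp_neg (integrable_cexp_mul_cosh_mul_cexp hz τ), besselK,
    ← integral_const_mul]
  congr 1 with s
  rw [Real.cosh_neg, Complex.cosh, Complex.ofReal_neg, mul_neg]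
  ring

/-- The product of the Macdonald functions at `r (1 + i)` and `r (1 - i)` is a cosine transform. -/
theorem besselK_mul_besselK_eq {r : ℝ} (hr : 0 < r) (τ : ℝ) :
    besselK (2 * Complex.I * τ) (r * (1 + Complex.I)) *
        besselK (2 * Complex.I * τ) (r * (1 - Complex.I)) =
      ((∫ u in Ioi (0 : ℝ), Real.cos (2 * u * τ) *
        besselK0 (2 * r * Real.sqrt (Real.cosh u)) : ℝ) : ℂ) := by
  have hz : 0 < ((r : ℂ) * (1 + Complex.I)).re := by simpa
  have hζ : 0 < ((r : ℂ) * (1 - Complex.I)).re := by simpa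
  have hg := integrable_cexp_mul_cosh_mul_cexp hz τ
  have hh := integrable_cexp_mul_cosh_mul_cexp hζ τ
  have hprod := integral_convolution (ContinuousLinearMap.mul ℝ ℂ) hg hh
  have hint := hg.integrable_convolution (ContinuousLinearMap.mul ℝ ℂ) hh
  have hconv : convolution (fun s : ℝ => Complex.exp (-(r * (1 + Complex.I)) * Real.cosh s) *
        Complex.exp (2 * Complex.I * τ * s))
      (fun s : ℝ => Complex.exp (-(r * (1 - Complex.I)) * Real.cosh s) *
        Complex.exp (2 * Complex.I * τ * s)) (ContinuousLinearMap.mul ℝ ℂ) volume =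
      fun u : ℝ => Complex.exp (2 * Complex.I * τ * u) *
        (2 * besselK0 (2 * r * Real.sqrt (Real.cosh u))) := by
    ext u
    rw [convolution, ← integral_cexp_neg_mul_cosh_add_cosh hr u, ← integral_const_mul]
    congr 1 with s
    rw [ContinuousLinearMap.mul_apply', show 2 * Complex.I * τ * u =
      2 * Complex.I * τ * s + 2 * Complex.I * τ * (u - s : ℝ) by push_cast; ring, Complex.exp_add]
    ring
  rw [hconv, integral_cexp_mul_cosh_mul_cexp hz, integral_cexp_mul_cosh_mul_cexp hζ,
    ContinuousLinearMap.mul_apply'] at hprod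
  rw [hconv] at hint
  rw [integral_eq_integral_Ioi_add_comp_neg hint] at hprod
  have hcos : ∫ u in Ioi (0 : ℝ), (Complex.exp (2 * Complex.I * τ * u) *
        (2 * besselK0 (2 * r * Real.sqrt (Real.cosh u))) +
      Complex.exp (2 * Complex.I * τ * (-u : ℝ)) *
        (2 * besselK0 (2 * r * Real.sqrt (Real.cosh (-u))))) =
      4 * ((∫ u in Ioi (0 : ℝ), Real.cos (2 * u * τ) *
        besselK0 (2 * r * Real.sqrt (Real.cosh u)) : ℝ) : ℂ) := by
    rw [← integral_complex_ofReal, ← integral_const_mul]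
    congr 1 with u
    rw [Real.cosh_neg]
    push_cast
    rw [Complex.cos]
    ring_nf
  rw [hcos] at hprod
  linear_combination -hprod / 4

theorem two_mul_four_mul_rpow_mul_exp {x : ℝ} (hx : 0 < x) (s : ℝ) (hs : s = 1 ∨ s = -1) :
    ((2 * (4*x) ^ ((1:ℝ)/4) : ℝ) : ℂ) * Complex.exp (s * (Complex.I * (Real.pi:ℂ)) / 4) =
      ((2 * x ^ ((1:ℝ)/4) : ℝ) : ℂ) * (1 + s * Complex.I) := by
  have h4 : (4 : ℝ) ^ ((1:ℝ)/4) = Real.sqrt 2 := by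
    rw [Real.sqrt_eq_rpow, show (4 : ℝ) = 2 ^ (2 : ℝ) by norm_num, ← Real.rpow_mul zero_le_two]
    norm_num
  have hsqrt : (Real.sqrt 2 : ℂ) ^ 2 = 2 := by
    exact_mod_cast Real.sq_sqrt zero_le_two
  have hexp : Complex.exp (s * (Complex.I * (Real.pi:ℂ)) / 4) =
      (Real.sqrt 2 : ℂ) / 2 * (1 + s * Complex.I) := by
    rw [show s * (Complex.I * (Real.pi:ℂ)) / 4 = ((s * (Real.pi / 4) : ℝ) : ℂ) * Complex.I by
      push_cast; ring, Complex.exp_mul_I, ← Complex.ofReal_cos, ← Complex.ofReal_sin]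
    rcases hs with rfl | rfl
    · rw [one_mul, Real.cos_pi_div_four, Real.sin_pi_div_four]
      push_cast
      ring
    · rw [neg_one_mul, Real.cos_neg, Real.sin_neg, Real.cos_pi_div_four, Real.sin_pi_div_four]
      push_cast
      ring
  rw [hexp, Real.mul_rpow zero_le_four hx.le, h4]
  push_cast
  linear_combination ((x ^ ((1:ℝ)/4) : ℝ) : ℂ) * (1 + s * Complex.I) * hsqrt

theorem kernelK_eq_integral {x : ℝ} (hx : 0 < x) (τ : ℝ) :
    kernelK x τ = ∫ u in Ioi (0 : ℝ), Real.cos (2 * u * τ) *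
      besselK0 (4 * x ^ ((1:ℝ)/4) * Real.sqrt (Real.cosh u)) := by
  have h1 := two_mul_four_mul_rpow_mul_exp hx 1 (Or.inl rfl)
  have h2 := two_mul_four_mul_rpow_mul_exp hx (-1) (Or.inr rfl)
  simp only [Complex.ofReal_one, Complex.ofReal_neg, one_mul, neg_mul, ← sub_eq_add_neg] at h1 h2
  rw [kernelK, h1, h2, besselK_mul_besselK_eq (by positivity), Complex.ofReal_re]
  congr! 4
  ring

/-- Composition representation (2.2) of the index transform (1.1) in terms of the
Fourier cosine and Meijer transforms, with absolute convergence of the iterated integral. -/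
theorem indexF_composition_repr (p q ν : ℝ) (hp : 1 ≤ p) (hq : q = p/(p-1)) (hν : ν < 1)
    (f : ℝ → ℝ) (hf : Measurable f)
    (hfin : MeasureTheory.IntegrableOn (fun x => |f x| ^ p * x ^ (ν*p - 1)) (Set.Ioi 0)) :
    ∀ τ : ℝ, 0 ≤ τ →
      MeasureTheory.IntegrableOn (fun ux : ℝ × ℝ =>
          Real.cos (2*ux.1*τ) * besselK0 (4 * ux.2 ^ ((1:ℝ)/4) * Real.sqrt (Real.cosh ux.1)) * f ux.2)
        ((Set.Ioi 0) ×ˢ (Set.Ioi 0)) ∧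
      indexF f τ = ∫ u in Set.Ioi (0:ℝ), Real.cos (2*u*τ) *
          ∫ x in Set.Ioi (0:ℝ), besselK0 (4 * x ^ ((1:ℝ)/4) * Real.sqrt (Real.cosh u)) * f x := by
  intro τ _
  have hK := integrableOn_besselK0_mul hp hν hf hfin
  have hint : IntegrableOn (fun ux : ℝ × ℝ =>
      Real.cos (2*ux.1*τ) * besselK0 (4 * ux.2 ^ ((1:ℝ)/4) * Real.sqrt (Real.cosh ux.1)) * f ux.2)
      (Ioi 0 ×ˢ Ioi 0) := by
    simp_rw [mul_assoc (Real.cos _)]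
    refine Integrable.bdd_mul (c := 1) hK (by fun_prop) (ae_of_all _ fun ux => ?_)
    exact Real.abs_cos_le_one _
  refine ⟨hint, ?_⟩
  have hprod := hint
  rw [IntegrableOn, Measure.volume_eq_prod, ← Measure.prod_restrict] at hprod
  calc indexF f τ
      = ∫ x in Ioi (0 : ℝ), ∫ u in Ioi (0 : ℝ), Real.cos (2*u*τ) *
          besselK0 (4 * x ^ ((1:ℝ)/4) * Real.sqrt (Real.cosh u)) * f x :=
        setIntegral_congr_fun measurableSet_Ioi fun x hx => by
          rw [kernelK_eq_integral hx, integral_mul_const]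
    _ = ∫ u in Ioi (0 : ℝ), ∫ x in Ioi (0 : ℝ), Real.cos (2*u*τ) *
          besselK0 (4 * x ^ ((1:ℝ)/4) * Real.sqrt (Real.cosh u)) * f x :=
        (integral_integral_swap hprod).symm
    _ = _ := by simp_rw [mul_assoc (Real.cos _), integral_const_mul]
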